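/- arXiv:2101.09724 — 2 statements merged into one kernel-verified Lean document; each statement's English description precedes it below -/
import Mathlib

section
/- In every tetravalent modal algebra A, for all a, b ∈ A the following hold: □□a = □a; □(a ∧ b) = □a ∧ □b; □(a ∨ □b) = □a ∨ □b; □¬□a = ¬□a; a ∧ □¬a = 0; □(□a ∧ □b) = □a ∧ □b; □(□a ∨ □b) = □a ∨ □b. -/
/-- A tetravalent modal algebra: a bounded distributive lattice with bottom `⊥` (= 0) and
top `⊤` (= ¬0), a De Morgan negation `compl` and a modal operator `box` satisfying
`□a ⊓ ¬a = 0` and `¬□a ⊓ a = ¬a ⊓ a`. -/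
class TMA (α : Type*) extends DistribLattice α, BoundedOrder α where
  compl : α → α
  box : α → α
  compl_compl : ∀ a : α, compl (compl a) = a
  compl_sup : ∀ a b : α, compl (a ⊔ b) = compl a ⊓ compl b
  compl_bot : compl (⊥ : α) = ⊤
  box_inf_compl : ∀ a : α, box a ⊓ compl a = ⊥
  compl_box_inf : ∀ a : α, compl (box a) ⊓ a = compl a ⊓ a

namespace TMA

variable {α : Type*} [TMA α] {x y a b : α}

theorem compl_inf (a b : α) : compl (a ⊓ b) = compl a ⊔ compl b := by
  rw [← compl_compl (compl a ⊔ compl b), compl_sup, compl_compl, compl_compl]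

theorem compl_anti (h : a ≤ b) : compl b ≤ compl a := by
  rw [← inf_eq_right, ← compl_sup, sup_eq_right.2 h]

/-- An element is Boolean if its De Morgan negation is a lattice complement. -/
def IsBoolean (x : α) : Prop := x ⊓ compl x = ⊥

theorem IsBoolean.sup_compl (hx : IsBoolean x) : x ⊔ compl x = ⊤ := by
  have h := congrArg compl hx
  rwa [compl_inf, compl_compl, compl_bot, sup_comm] at h

theorem IsBoolean.compl (hx : IsBoolean x) : IsBoolean (TMA.compl x) := by
  rw [IsBoolean, compl_compl, inf_comm]
  exact hx

theorem IsBoolean.inf (hx : IsBoolean x) (hy : IsBoolean y) : IsBoolean (x ⊓ y) := by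
  rw [IsBoolean, compl_inf, inf_sup_left, inf_right_comm, hx, inf_assoc, hy]
  simp

theorem IsBoolean.sup (hx : IsBoolean x) (hy : IsBoolean y) : IsBoolean (x ⊔ y) := by
  have h := (hx.compl.inf hy.compl).compl
  rwa [compl_inf, compl_compl, compl_compl] at h

theorem IsBoolean.le_sup_iff (hx : IsBoolean x) : a ≤ b ⊔ x ↔ a ⊓ TMA.compl x ≤ b := by
  constructor
  · intro h
    calc a ⊓ TMA.compl x ≤ (b ⊔ x) ⊓ TMA.compl x := inf_le_inf_right _ h
      _ = b ⊓ TMA.compl x := by rw [inf_sup_right, hx, sup_bot_eq]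
      _ ≤ b := inf_le_left
  · intro h
    calc a ≤ a ⊔ x := le_sup_left
      _ = a ⊓ TMA.compl x ⊔ x := by
        rw [sup_inf_right, sup_comm (TMA.compl x), hx.sup_compl, inf_top_eq]
      _ ≤ b ⊔ x := sup_le_sup_right h x

theorem box_le (a : α) : box a ≤ a := by
  have h := congrArg compl (compl_box_inf a)
  rw [compl_inf, compl_inf, compl_compl, compl_compl] at h
  have h' : box a ≤ a ⊔ compl a := h ▸ le_sup_left
  calc box a ≤ box a ⊓ (a ⊔ compl a) := le_inf le_rfl h'
    _ = box a ⊓ a := by rw [inf_sup_left, box_inf_compl, sup_bot_eq]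
    _ ≤ a := inf_le_right

theorem isBoolean_box (a : α) : IsBoolean (box a) := by
  refine le_bot_iff.1 ?_
  calc box a ⊓ compl (box a) ≤ box a ⊓ (compl (box a) ⊓ a) :=
        le_inf inf_le_left (le_inf inf_le_right (inf_le_left.trans (box_le a)))
    _ = ⊥ := by rw [compl_box_inf, ← inf_assoc, box_inf_compl, bot_inf_eq]

/-- `box a` is the greatest Boolean element below `a`. -/
theorem IsBoolean.le_box_iff (hx : IsBoolean x) : x ≤ box a ↔ x ≤ a := by
  refine ⟨fun h => h.trans (box_le a), fun h => ?_⟩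
  have key : x ⊓ TMA.compl (box a) ≤ ⊥ := by
    calc x ⊓ TMA.compl (box a) ≤ x ⊓ (TMA.compl (box a) ⊓ a) :=
          le_inf inf_le_left (le_inf inf_le_right (inf_le_left.trans h))
      _ = x ⊓ (TMA.compl a ⊓ a) := by rw [compl_box_inf]
      _ ≤ x ⊓ TMA.compl x := inf_le_inf_left x (inf_le_left.trans (compl_anti h))
      _ = ⊥ := hx
  simpa using (isBoolean_box a).le_sup_iff.2 key

theorem IsBoolean.box_eq (hx : IsBoolean x) : box x = x :=
  le_antisymm (box_le x) (hx.le_box_iff.2 le_rfl)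

theorem box_mono (h : a ≤ b) : box a ≤ box b :=
  (isBoolean_box a).le_box_iff.2 ((box_le a).trans h)

theorem box_inf (a b : α) : box (a ⊓ b) = box a ⊓ box b :=
  le_antisymm (le_inf (box_mono inf_le_left) (box_mono inf_le_right))
    (((isBoolean_box a).inf (isBoolean_box b)).le_box_iff.2 (inf_le_inf (box_le a) (box_le b)))

theorem IsBoolean.box_sup (hx : IsBoolean x) (a : α) : box (a ⊔ x) = box a ⊔ x := by
  refine le_antisymm ?_ (sup_le (box_mono le_sup_left) (hx.le_box_iff.2 le_sup_right))
  rw [hx.le_sup_iff, ((isBoolean_box _).inf hx.compl).le_box_iff, ← hx.le_sup_iff]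
  exact box_le _

end TMA

theorem tma_box_properties {α : Type*} [TMA α] (a b : α) :
    TMA.box (TMA.box a) = TMA.box a ∧
    TMA.box (a ⊓ b) = TMA.box a ⊓ TMA.box b ∧
    TMA.box (a ⊔ TMA.box b) = TMA.box a ⊔ TMA.box b ∧
    TMA.box (TMA.compl (TMA.box a)) = TMA.compl (TMA.box a) ∧
    a ⊓ TMA.box (TMA.compl a) = ⊥ ∧
    TMA.box (TMA.box a ⊓ TMA.box b) = TMA.box a ⊓ TMA.box b ∧
    TMA.box (TMA.box a ⊔ TMA.box b) = TMA.box a ⊔ TMA.box b := by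
  have ha := TMA.isBoolean_box a
  have hb := TMA.isBoolean_box b
  refine ⟨ha.box_eq, TMA.box_inf a b, hb.box_sup a, ha.compl.box_eq, ?_,
    (ha.inf hb).box_eq, (ha.sup hb).box_eq⟩
  have h := TMA.box_inf_compl (TMA.compl a)
  rwa [TMA.compl_compl, inf_comm] at h
end

section
/- Let A be a tetravalent modal algebra and x, y, z ∈ A. If x ≤ y ∨ z and x ∧ ¬z ≤ y, then x ≤ y ∨ □z. -/
theorem TMA.compl_inf_s2 {α : Type*} [TMA α] (a b : α) :
    TMA.compl (a ⊓ b) = TMA.compl a ⊔ TMA.compl b := by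
  rw [← TMA.compl_compl (TMA.compl a ⊔ TMA.compl b), TMA.compl_sup, TMA.compl_compl,
    TMA.compl_compl]

theorem TMA.box_sup_compl {α : Type*} [TMA α] (a : α) :
    TMA.box a ⊔ TMA.compl a = a ⊔ TMA.compl a := by
  have h := congrArg TMA.compl (TMA.compl_box_inf a)
  simpa only [TMA.compl_inf_s2, TMA.compl_compl] using h

theorem tma_le_sup_box {α : Type*} [TMA α] (x y z : α)
    (h1 : x ≤ y ⊔ z) (h2 : x ⊓ TMA.compl z ≤ y) :
    x ≤ y ⊔ TMA.box z := by
  have hz : z ≤ TMA.box z ⊔ TMA.compl z := le_sup_left.trans_eq (TMA.box_sup_compl z).symm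
  have hx : x ≤ (y ⊔ TMA.box z) ⊔ TMA.compl z :=
    h1.trans ((sup_le_sup_left hz y).trans_eq (sup_assoc _ _ _).symm)
  calc x = x ⊓ ((y ⊔ TMA.box z) ⊔ TMA.compl z) := (inf_eq_left.mpr hx).symm
    _ = x ⊓ (y ⊔ TMA.box z) ⊔ x ⊓ TMA.compl z := inf_sup_left _ _ _
    _ ≤ y ⊔ TMA.box z := sup_le inf_le_right (h2.trans le_sup_left)
end
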